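/- arXiv:1102.5574 — 5 statements merged into one kernel-verified Lean document; each statement's English description precedes it below -/
import Mathlib

section
/- Let p_1, ..., p_n be distinct primes, N = p_1^{α_1}···p_n^{α_n} with each α_i ≥ 1, and let D be a maximal N-set. Let N' = p_1···p_n, A = { d : d ∣ N', d ∈ D }, and α(d) = ∏_{p_i ∣ d} α_i. Then |D| = Σ_{d ∈ A} α(d). -/
open Finset

/-- `D` is an `N`-set: a set of positive divisors of `N`, no two elements of which
are coprime. -/
def IsNSet (N : ℕ) (D : Finset ℕ) : Prop :=
  (∀ d ∈ D, d ∣ N) ∧ (∀ d ∈ D, ∀ e ∈ D, Nat.gcd d e ≠ 1)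

/-- An `N`-set `D` is maximal if no further divisor of `N` can be added while keeping
the property that no two elements are coprime. -/
def IsMaxNSet (N : ℕ) (D : Finset ℕ) : Prop :=
  IsNSet N D ∧ ∀ l, l ∣ N → l ∉ D → ∃ d ∈ D, Nat.gcd l d = 1

/-- `dSet D` is the set of divisible minimal elements of `D`: those elements of `D`
not divisible by any other element of `D`. -/
def dSet (D : Finset ℕ) : Finset ℕ :=
  D.filter fun d => ∀ e ∈ D, e ∣ d → e = d

/-- `RSet T N` is `R(T, N)`: the set of positive divisors of `N` divisible by at least
one element of `T`. -/
def RSet (T : Finset ℕ) (N : ℕ) : Finset ℕ :=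
  N.divisors.filter fun l => ∃ t ∈ T, t ∣ l

/-- Membership in a maximal `N`-set depends only on the set of prime factors. -/
lemma IsMaxNSet.mem_of_primeFactors_eq {N : ℕ} {D : Finset ℕ} (hD : IsMaxNSet N D) (hN : N ≠ 0)
    {a b : ℕ} (ha : a ∈ D) (hb : b ∣ N) (hab : a.primeFactors = b.primeFactors) : b ∈ D := by
  by_contra hbD
  obtain ⟨d, hd, hbd⟩ := hD.2 b hb hbD
  have ha0 : a ≠ 0 := ne_zero_of_dvd_ne_zero hN (hD.1.1 a ha)
  have hb0 : b ≠ 0 := ne_zero_of_dvd_ne_zero hN hb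
  have hd0 : d ≠ 0 := ne_zero_of_dvd_ne_zero hN (hD.1.1 d hd)
  refine hD.1.2 a ha d hd ?_
  change Nat.Coprime b d at hbd
  change Nat.Coprime a d
  rw [← Nat.disjoint_primeFactors hb0 hd0] at hbd
  rwa [← Nat.disjoint_primeFactors ha0 hd0, hab]

section PrimePowers

variable {ι : Type*} [Fintype ι] {p : ι → ℕ}

lemma factorization_prod_prime_pow_apply (hp : ∀ i, (p i).Prime) (hinj : Function.Injective p)
    (f : ι → ℕ) (j : ι) : (∏ i, p i ^ f i).factorization (p j) = f j := by
  classical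
  rw [Nat.factorization_prod_apply fun i _ => pow_ne_zero _ (hp i).ne_zero]
  simp [(hp _).factorization, Finsupp.single_apply, hinj.eq_iff]

lemma exists_eq_of_prime_dvd_prod_pow (hp : ∀ i, (p i).Prime) (f : ι → ℕ) {q : ℕ}
    (hq : q.Prime) (h : q ∣ ∏ i, p i ^ f i) : ∃ i, q = p i := by
  obtain ⟨i, -, hi⟩ := (hq.prime.dvd_finsetProd_iff _).1 h
  exact ⟨i, (Nat.prime_dvd_prime_iff_eq hq (hp i)).1 (hq.dvd_of_dvd_pow hi)⟩

lemma prod_prime_pow_ne_zero (hp : ∀ i, (p i).Prime) (f : ι → ℕ) : ∏ i, p i ^ f i ≠ 0 :=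
  Finset.prod_ne_zero_iff.2 fun i _ => pow_ne_zero _ (hp i).ne_zero

lemma prime_dvd_prod_prime_pow_iff (hp : ∀ i, (p i).Prime) (hinj : Function.Injective p)
    (f : ι → ℕ) (j : ι) : p j ∣ ∏ i, p i ^ f i ↔ f j ≠ 0 := by
  rw [(hp j).dvd_iff_one_le_factorization (prod_prime_pow_ne_zero hp f),
    factorization_prod_prime_pow_apply hp hinj, Nat.one_le_iff_ne_zero]

lemma prod_pow_factorization_of_dvd (hp : ∀ i, (p i).Prime) (hinj : Function.Injective p)
    {α : ι → ℕ} {l : ℕ} (hl : l ∣ ∏ i, p i ^ α i) : ∏ i, p i ^ l.factorization (p i) = l := by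
  have hl0 : l ≠ 0 := ne_zero_of_dvd_ne_zero (prod_prime_pow_ne_zero hp α) hl
  refine Nat.eq_of_factorization_eq (prod_prime_pow_ne_zero hp _) hl0 fun q => ?_
  by_cases hq : ∃ i, q = p i
  · obtain ⟨i, rfl⟩ := hq
    exact factorization_prod_prime_pow_apply hp hinj _ i
  · by_cases hqp : q.Prime
    · rw [Nat.factorization_eq_zero_of_not_dvd
          fun h => hq (exists_eq_of_prime_dvd_prod_pow hp _ hqp h),
        Nat.factorization_eq_zero_of_not_dvd
          fun h => hq (exists_eq_of_prime_dvd_prod_pow hp _ hqp (h.trans hl))]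
    · simp [Nat.factorization_eq_zero_of_not_prime _ hqp]

/-- The number of divisors of `∏ i, p i ^ α i` with the same prime factors as the divisor `d`
is the product of the exponents `α i` over the primes `p i` dividing `d`. -/
lemma card_divisors_filter_primeFactors_eq (hp : ∀ i, (p i).Prime) (hinj : Function.Injective p)
    {α : ι → ℕ} {d : ℕ} (hd : d ∣ ∏ i, p i ^ α i) :
    #{l ∈ (∏ i, p i ^ α i).divisors | l.primeFactors = d.primeFactors} =
      ∏ i with p i ∣ d, α i := by
  classical
  have hN0 := prod_prime_pow_ne_zero hp α
  have hd0 : d ≠ 0 := ne_zero_of_dvd_ne_zero hN0 hd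
  have hcard : #(Fintype.piFinset fun i => if p i ∣ d then Icc 1 (α i) else {0}) =
      ∏ i with p i ∣ d, α i := by
    rw [Fintype.card_piFinset, prod_filter]
    refine prod_congr rfl fun i _ => ?_
    split_ifs <;> simp
  rw [← hcard]
  refine card_nbij' (fun l i => l.factorization (p i)) (fun f => ∏ i, p i ^ f i) ?_ ?_ ?_ ?_
  · intro l hl
    simp only [coe_filter, Nat.mem_divisors, Set.mem_ofPred_eq] at hl
    obtain ⟨⟨hlN, -⟩, hld⟩ := hl
    have hl0 : l ≠ 0 := ne_zero_of_dvd_ne_zero hN0 hlN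
    rw [mem_coe, Fintype.mem_piFinset]
    intro i
    have hi : p i ∣ l ↔ p i ∣ d := by
      simpa [hp i, hl0, hd0] using Finset.ext_iff.1 hld (p i)
    split_ifs with h
    · rw [mem_Icc]
      refine ⟨((hp i).dvd_iff_one_le_factorization hl0).1 (hi.2 h), ?_⟩
      rw [← factorization_prod_prime_pow_apply hp hinj α i]
      exact (Nat.factorization_le_iff_dvd hl0 hN0).2 hlN (p i)
    · rw [mem_singleton]
      exact Nat.factorization_eq_zero_of_not_dvd fun h' => h (hi.1 h')
  · intro f hf
    rw [mem_coe, Fintype.mem_piFinset] at hf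
    have hfi : ∀ i, (f i ≠ 0 ↔ p i ∣ d) ∧ f i ≤ α i := by
      intro i
      have := hf i
      split_ifs at this with h
      · rw [mem_Icc] at this
        exact ⟨iff_of_true (by omega) h, this.2⟩
      · rw [mem_singleton] at this
        exact ⟨iff_of_false (by omega) h, by omega⟩
    simp only [coe_filter, Nat.mem_divisors, Set.mem_ofPred_eq]
    refine ⟨⟨prod_dvd_prod_of_dvd _ _ fun i _ => pow_dvd_pow _ (hfi i).2, hN0⟩, ?_⟩
    ext q
    simp only [Nat.mem_primeFactors]
    refine and_congr_right fun hq => and_congr ?_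
      (iff_of_true (prod_prime_pow_ne_zero hp f) hd0)
    by_cases h : ∃ i, q = p i
    · obtain ⟨i, rfl⟩ := h
      rw [prime_dvd_prod_prime_pow_iff hp hinj, (hfi i).1]
    · exact iff_of_false (fun h' => h (exists_eq_of_prime_dvd_prod_pow hp f hq h'))
        fun h' => h (exists_eq_of_prime_dvd_prod_pow hp α hq (h'.trans hd))
  · intro l hl
    simp only [coe_filter, Nat.mem_divisors, Set.mem_ofPred_eq] at hl
    exact prod_pow_factorization_of_dvd hp hinj hl.1.1
  · intro f _
    exact funext fun i => factorization_prod_prime_pow_apply hp hinj f i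

end PrimePowers

/-- Let `N = p₁^{α₁} ⋯ p_n^{α_n}` (distinct primes, each `α_i ≥ 1`), `D` a maximal
`N`-set, `N' = p₁ ⋯ p_n`, `A = {d ∣ N' : d ∈ D}` and `α(d) = ∏_{p_i ∣ d} α_i`.
Then `|D| = Σ_{d ∈ A} α(d)`. -/
theorem stmt_13 (n : ℕ) (p α : Fin n → ℕ)
    (hp : ∀ i, (p i).Prime) (hinj : Function.Injective p)
    (hα : ∀ i, 1 ≤ α i)
    (N : ℕ) (hN : N = ∏ i, p i ^ α i)
    (N' : ℕ) (hN' : N' = ∏ i, p i)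
    (D : Finset ℕ) (hD : IsMaxNSet N D)
    (A : Finset ℕ) (hA : A = D.filter fun d => d ∣ N')
    (αf : ℕ → ℕ)
    (hαf : ∀ d, αf d = ∏ i ∈ Finset.univ.filter (fun i : Fin n => p i ∣ d), α i) :
    D.card = ∑ d ∈ A, αf d := by
  have hN0 : N ≠ 0 := hN ▸ prod_prime_pow_ne_zero hp α
  have hN'N : N' ∣ N := by
    rw [hN, hN']
    exact prod_dvd_prod_of_dvd _ _ fun i _ => dvd_pow_self _ (by have := hα i; omega)
  have hsq : Squarefree N' := by
    rw [hN']
    refine squarefree_prod_of_pairwise_isCoprime (fun i _ j _ hij => ?_)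
      fun i _ => (hp i).prime.squarefree
    exact Nat.coprime_iff_isRelPrime.1 ((Nat.coprime_primes (hp i) (hp j)).2 (hinj.ne hij))
  have hrad : ∀ l : ℕ, (∏ q ∈ l.primeFactors, q).primeFactors = l.primeFactors := fun l =>
    Nat.primeFactors_prod fun q hq => Nat.prime_of_mem_primeFactors hq
  have hmaps : ∀ l ∈ D, ∏ q ∈ l.primeFactors, q ∈ A := by
    intro l hl
    have hlN := hD.1.1 l hl
    have hlN' : ∏ q ∈ l.primeFactors, q ∣ N' := by
      rw [← Nat.prod_primeFactors_of_squarefree hsq]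
      refine prod_dvd_prod_of_subset _ _ _ fun q hq => ?_
      have hqp := Nat.prime_of_mem_primeFactors hq
      obtain ⟨i, rfl⟩ := exists_eq_of_prime_dvd_prod_pow hp α hqp
        (hN ▸ (Nat.dvd_of_mem_primeFactors hq).trans hlN)
      exact Nat.mem_primeFactors.2 ⟨hqp, hN' ▸ dvd_prod_of_mem _ (mem_univ i), hsq.ne_zero⟩
    rw [hA, mem_filter]
    exact ⟨hD.mem_of_primeFactors_eq hN0 hl (hlN'.trans hN'N) (hrad l).symm, hlN'⟩
  rw [card_eq_sum_card_fiberwise hmaps]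
  refine sum_congr rfl fun d hd => ?_
  rw [hA, mem_filter] at hd
  have hdN : d ∣ ∏ i, p i ^ α i := hN ▸ hD.1.1 d hd.1
  rw [hαf, ← card_divisors_filter_primeFactors_eq hp hinj hdN, ← hN]
  congr 1
  ext l
  simp only [mem_filter, Nat.mem_divisors]
  constructor
  · rintro ⟨hl, rfl⟩
    exact ⟨⟨hD.1.1 l hl, hN0⟩, (hrad l).symm⟩
  · rintro ⟨⟨hl, -⟩, hld⟩
    exact ⟨hD.mem_of_primeFactors_eq hN0 hd.1 hl hld.symm,
      hld ▸ Nat.prod_primeFactors_of_squarefree (hsq.squarefree_of_dvd hd.2)⟩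
end

section
/- Let p_1, ..., p_n be distinct primes, N = p_1^{α_1}···p_n^{α_n} with α_1 ≥ α_2 ≥ ... ≥ α_n ≥ 1. If D is a set of divisors of N such that no two members of D are coprime and no additional divisor of N may be included in D without introducing two coprime members, then |D| ≥ α_n · ∏_{i=1}^{n-1} (α_i + 1). -/
open Finset

section ExponentVectors

variable {n : ℕ} {p α : Fin n → ℕ}

/-- The divisor `∏ pᵢ ^ xᵢ` with exponent vector `x`. -/
def divisorOfExponents (p α : Fin n → ℕ) (x : ∀ i, Fin (α i + 1)) : ℕ :=
  ∏ i, p i ^ (x i : ℕ)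

theorem divisorOfExponents_dvd (x : ∀ i, Fin (α i + 1)) :
    divisorOfExponents p α x ∣ ∏ i, p i ^ α i :=
  Finset.prod_dvd_prod_of_dvd _ _ fun i _ => pow_dvd_pow _ (Nat.lt_succ_iff.mp (x i).isLt)

theorem factorization_divisorOfExponents (hp : ∀ i, (p i).Prime)
    (hinj : Function.Injective p) (x : ∀ i, Fin (α i + 1)) (i : Fin n) :
    (divisorOfExponents p α x).factorization (p i) = x i := by
  rw [divisorOfExponents, Nat.factorization_prod fun j _ => pow_ne_zero _ (hp j).ne_zero,
    Finset.sum_apply', Finset.sum_eq_single i]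
  · simp [(hp i).factorization]
  · intro j _ hj
    simp [(hp j).factorization, hinj.ne hj]
  · simp

theorem divisorOfExponents_injective (hp : ∀ i, (p i).Prime) (hinj : Function.Injective p) :
    Function.Injective (divisorOfExponents p α) := by
  intro x y h
  funext i
  rw [Fin.ext_iff, ← factorization_divisorOfExponents hp hinj x,
    ← factorization_divisorOfExponents hp hinj y, h]

/-- Exchange the exponents `0` and `t` in every coordinate. -/
def swapExponents {a : ℕ} (ha : ∀ i, a ≤ α i) (t : Fin (a + 1)) (x : ∀ i, Fin (α i + 1)) :
    ∀ i, Fin (α i + 1) :=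
  fun i => Equiv.swap 0 (Fin.castLE (Nat.succ_le_succ (ha i)) t) (x i)

theorem swapExponents_involutive {a : ℕ} (ha : ∀ i, a ≤ α i) (t : Fin (a + 1)) :
    Function.Involutive (swapExponents ha t) := by
  intro x
  funext i
  simp [swapExponents]

theorem eq_castLE_of_coprime_swapExponents {a : ℕ} (ha : ∀ i, a ≤ α i) {t : Fin (a + 1)}
    {x : ∀ i, Fin (α i + 1)} {i : Fin n} {d : ℕ} (hp : (p i).Prime)
    (h : Nat.gcd (divisorOfExponents p α (swapExponents ha t x)) d = 1) (hd : p i ∣ d) :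
    x i = Fin.castLE (Nat.succ_le_succ (ha i)) t := by
  have h0 : swapExponents ha t x i = 0 := by
    by_contra hne
    refine Nat.not_coprime_of_dvd_of_dvd hp.one_lt ?_ hd h
    exact (dvd_pow_self _ (Fin.val_ne_zero_iff.mpr hne)).trans
      (Finset.dvd_prod_of_mem (fun j => p j ^ (swapExponents ha t x j : ℕ)) (mem_univ i))
  rw [swapExponents, Equiv.swap_apply_eq_iff, Equiv.swap_apply_left] at h0
  exact h0

/-- At most one of the exchanges of `x` has its divisor outside a maximal `N`-set. -/
theorem IsMaxNSet.eq_of_swapExponents_notMem {a : ℕ} (ha : ∀ i, a ≤ α i)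
    (hp : ∀ i, (p i).Prime) {D : Finset ℕ} (hD : IsMaxNSet (∏ i, p i ^ α i) D)
    {s t : Fin (a + 1)} {x : ∀ i, Fin (α i + 1)}
    (hs : divisorOfExponents p α (swapExponents ha s x) ∉ D)
    (ht : divisorOfExponents p α (swapExponents ha t x) ∉ D) : s = t := by
  obtain ⟨d, hd, hsd⟩ := hD.2 _ (divisorOfExponents_dvd _) hs
  obtain ⟨e, he, hte⟩ := hD.2 _ (divisorOfExponents_dvd _) ht
  obtain ⟨q, hq, hqd, hqe⟩ := Nat.Prime.not_coprime_iff_dvd.mp (hD.1.2 d hd e he)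
  obtain ⟨i, -, hqi⟩ := hq.prime.exists_mem_finset_dvd (hqd.trans (hD.1.1 d hd))
  obtain rfl := (Nat.prime_dvd_prime_iff_eq hq (hp i)).mp (hq.dvd_of_dvd_pow hqi)
  have h := (eq_castLE_of_coprime_swapExponents ha hq hsd hqd).symm.trans
    (eq_castLE_of_coprime_swapExponents ha hq hte hqe)
  exact Fin.castLE_injective _ h

theorem IsMaxNSet.succ_mul_card_notMem_le {a : ℕ} (ha : ∀ i, a ≤ α i)
    (hp : ∀ i, (p i).Prime) {D : Finset ℕ} (hD : IsMaxNSet (∏ i, p i ^ α i) D) :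
    (a + 1) * #{x | divisorOfExponents p α x ∉ D} ≤ ∏ i, (α i + 1) := by
  calc
    _ = #((univ : Finset (Fin (a + 1))) ×ˢ
        ({x | divisorOfExponents p α x ∉ D} : Finset (∀ i, Fin (α i + 1)))) := by simp
    _ ≤ #(univ : Finset (∀ i, Fin (α i + 1))) := by
      refine Finset.card_le_card_of_injOn (fun y => swapExponents ha y.1 y.2) (by simp) ?_
      rintro ⟨s, x⟩ hx ⟨t, y⟩ hy hxy
      simp only [coe_product, Set.mem_prod, mem_coe, mem_filter_univ] at hx hy hxy
      have hst : s = t := by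
        refine hD.eq_of_swapExponents_notMem ha hp (x := swapExponents ha s x) ?_ ?_
        · rw [swapExponents_involutive ha s x]
          exact hx.2
        · rw [hxy, swapExponents_involutive ha t y]
          exact hy.2
      subst hst
      rw [(swapExponents_involutive ha s).injective hxy]
    _ = _ := by simp

theorem card_divisorOfExponents_mem_le (hp : ∀ i, (p i).Prime)
    (hinj : Function.Injective p) (D : Finset ℕ) :
    #{x | divisorOfExponents p α x ∈ D} ≤ #D :=
  Finset.card_le_card_of_injOn (divisorOfExponents p α) (by simp [Set.MapsTo])
    (divisorOfExponents_injective hp hinj).injOn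

end ExponentVectors

/-- **Theorem C (Erdős–Herzog–Schönheim).** Let `N = p₁^{α₁} ⋯ p_n^{α_n}` with
`α₁ ≥ α₂ ≥ ⋯ ≥ α_n ≥ 1` (distinct primes). If `D` is a maximal `N`-set, then
`|D| ≥ α_n ∏_{i=1}^{n-1} (α_i + 1)`. -/
theorem stmt_15 (n : ℕ) (hn : 0 < n) (p α : Fin n → ℕ)
    (hp : ∀ i, (p i).Prime) (hinj : Function.Injective p)
    (hα : ∀ i, 1 ≤ α i)
    (hanti : ∀ i j : Fin n, i ≤ j → α j ≤ α i)
    (N : ℕ) (hN : N = ∏ i, p i ^ α i)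
    (D : Finset ℕ) (hD : IsMaxNSet N D) :
    α ⟨n - 1, by omega⟩ * ∏ i ∈ Finset.univ.erase ⟨n - 1, by omega⟩, (α i + 1) ≤
      D.card := by
  subst hN
  have ha : ∀ i, α ⟨n - 1, by omega⟩ ≤ α i := fun i =>
    hanti i _ (Fin.mk_le_mk.mpr (Nat.le_sub_one_of_lt i.isLt))
  have hle := hD.succ_mul_card_notMem_le ha hp
  have hmem := card_divisorOfExponents_mem_le (α := α) hp hinj D
  have hsplit := Finset.card_filter_add_card_filter_not (s := univ)
    (fun x => divisorOfExponents p α x ∈ D)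
  have hcard : #(univ : Finset (∀ i, Fin (α i + 1))) = ∏ i, (α i + 1) := by simp
  have hprod := Finset.mul_prod_erase univ (fun i => α i + 1)
    (mem_univ (⟨n - 1, by omega⟩ : Fin n))
  rw [← hprod] at hle hcard
  have hnot := Nat.le_of_mul_le_mul_left hle (Nat.succ_pos _)
  rw [hcard, add_one_mul] at hsplit
  omega
end

section
/- Let p_1, ..., p_n be distinct primes and N = p_1 p_2 ··· p_n. If A = {d_1, ..., d_m} is a set of divisors of N such that gcd(d_i, d_j) > 1 for all i, j, and no additional divisor of N may be included in A without violating this property, then m = 2^{n-1}. -/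
open Finset

/-- A product of distinct primes has two to the number of factors many divisors. -/
theorem card_divisors_prod_primes {ι : Type*} (s : Finset ι) (p : ι → ℕ)
    (hp : ∀ i ∈ s, (p i).Prime) (hinj : Set.InjOn p s) :
    (∏ i ∈ s, p i).divisors.card = 2 ^ s.card := by
  classical
  induction s using Finset.induction_on with
  | empty => simp
  | insert a s ha ih =>
    have hcop : Nat.Coprime (p a) (∏ i ∈ s, p i) := by
      refine Nat.Coprime.prod_right fun i hi => ?_
      refine (Nat.coprime_primes (hp a (by simp)) (hp i (by simp [hi]))).2 fun h => ha ?_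
      rwa [hinj (by simp) (by simp [hi]) h]
    rw [prod_insert ha, hcop.card_divisors_mul,
      ih (fun i hi => hp i (by simp [hi])) (hinj.mono (by simp)),
      (hp a (by simp)).divisors, card_pair (hp a (by simp)).one_lt.ne, card_insert_of_notMem ha,
      pow_succ, mul_comm]

/-- A product of distinct primes is squarefree. -/
theorem squarefree_prod_primes {ι : Type*} (s : Finset ι) (p : ι → ℕ)
    (hp : ∀ i ∈ s, (p i).Prime) (hinj : Set.InjOn p s) :
    Squarefree (∏ i ∈ s, p i) :=
  Finset.squarefree_prod_of_pairwise_isCoprime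
    (fun i hi j hj hij => Nat.coprime_iff_isRelPrime.1 <|
      (Nat.coprime_primes (hp i hi) (hp j hj)).2 fun h => hij (hinj hi hj h))
    fun i hi => (hp i hi).prime.squarefree

/-- A maximal `N`-set is closed under passing to multiples dividing `N`. -/
theorem IsMaxNSet.mem_of_dvd {N : ℕ} {A : Finset ℕ} (hA : IsMaxNSet N A) {d e : ℕ}
    (hd : d ∈ A) (hde : d ∣ e) (he : e ∣ N) : e ∈ A := by
  by_contra h
  obtain ⟨c, hc, hec⟩ := hA.2 e he h
  exact hA.1.2 d hd c hc (Nat.Coprime.coprime_dvd_left hde hec)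

/-- For squarefree `N`, a maximal `N`-set contains exactly one of `d` and `N / d`. -/
theorem IsMaxNSet.div_mem_iff {N : ℕ} (hN : Squarefree N) {A : Finset ℕ} (hA : IsMaxNSet N A)
    {d : ℕ} (hd : d ∣ N) : N / d ∈ A ↔ d ∉ A := by
  constructor
  · intro h h'
    exact hA.1.2 d h' _ h <| Nat.coprime_of_squarefree_mul <| by rwa [Nat.mul_div_cancel' hd]
  · intro h
    obtain ⟨c, hc, hdc⟩ := hA.2 d hd h
    refine hA.mem_of_dvd hc ?_ (Nat.div_dvd_of_dvd hd)
    refine Nat.Coprime.dvd_of_dvd_mul_left (Nat.Coprime.symm hdc) ?_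
    rw [Nat.mul_div_cancel' hd]
    exact hA.1.1 c hc

/-- For squarefree `N`, a maximal `N`-set contains half of the divisors of `N`. -/
theorem IsMaxNSet.two_mul_card {N : ℕ} (hN : Squarefree N) {A : Finset ℕ}
    (hA : IsMaxNSet N A) : 2 * A.card = N.divisors.card := by
  have hsub : A ⊆ N.divisors := fun d hd => Nat.mem_divisors.2 ⟨hA.1.1 d hd, hN.ne_zero⟩
  have hcard : A.card = (N.divisors \ A).card := by
    refine card_nbij' (fun d => N / d) (fun d => N / d) ?_ ?_ ?_ ?_
    · intro d hd
      have hdN := hA.1.1 d hd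
      have := hA.div_mem_iff hN hdN
      simp_all [Nat.div_dvd_of_dvd hdN, hN.ne_zero]
    · intro d hd
      obtain ⟨hdN, hdA⟩ := mem_sdiff.1 hd
      exact (hA.div_mem_iff hN (Nat.dvd_of_mem_divisors hdN)).2 hdA
    · intro d hd
      exact Nat.div_div_self (hA.1.1 d hd) hN.ne_zero
    · intro d hd
      exact Nat.div_div_self (Nat.dvd_of_mem_divisors (mem_sdiff.1 hd).1) hN.ne_zero
  have := card_sdiff_add_card_eq_card hsub
  omega

/-- **Theorem B (Erdős–Ko–Rado, divisor form).** Let `N = p₁ p₂ ⋯ p_n` (distinct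
primes). If `A` is a set of divisors of `N` with `gcd(d, e) > 1` for all `d, e ∈ A`,
and no further divisor of `N` can be added keeping this property, then
`|A| = 2^{n-1}`. -/
theorem stmt_16 (n : ℕ) (hn : 0 < n) (p : Fin n → ℕ)
    (hp : ∀ i, (p i).Prime) (hinj : Function.Injective p)
    (N : ℕ) (hN : N = ∏ i, p i)
    (A : Finset ℕ) (hA : IsMaxNSet N A) :
    A.card = 2 ^ (n - 1) := by
  have hsq : Squarefree N := hN ▸ squarefree_prod_primes univ p (fun i _ => hp i) hinj.injOn
  have hcard := card_divisors_prod_primes univ p (fun i _ => hp i) hinj.injOn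
  rw [← hN, card_univ, Fintype.card_fin, ← hA.two_mul_card hsq] at hcard
  obtain ⟨k, rfl⟩ := Nat.exists_eq_succ_of_ne_zero hn.ne'
  rw [Nat.succ_sub_one]
  rw [pow_succ] at hcard
  omega
end

section
/- Let M be a squarefree positive integer and for d ∣ M write d̄' = M/d. If F = {d_1, ..., d_s} is a set of divisors of M such that whenever d_i ∈ F and d_i ∣ d ∣ M then d ∈ F, then there exists a permutation i_1, ..., i_s of 1, ..., s such that d̄'_{i_j} divides d_j for every j with 1 ≤ j ≤ s. -/
open Finset

open scoped FinsetFamily in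
/-- For `F` an upward closed set of divisors of a squarefree `M` and `S ⊆ F`, at least `S.card`
elements `e` of `F` are such that `M / e` divides a member of `S`. This is the Marica–Schönheim
inequality `Finset.card_le_card_diffs` applied to sets of prime factors. -/
theorem card_le_card_filter_div_dvd {M : ℕ} (hsf : Squarefree M) {F S : Finset ℕ}
    (hFdvd : ∀ d ∈ F, d ∣ M) (hFup : ∀ d ∈ F, ∀ e, d ∣ e → e ∣ M → e ∈ F) (hSF : S ⊆ F) :
    S.card ≤ (F.filter fun e => ∃ d ∈ S, M / e ∣ d).card := by
  have hM : M ≠ 0 := hsf.ne_zero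
  have hprod : ∀ d ∈ F, ∏ p ∈ d.primeFactors, p = d := fun d hd =>
    Nat.prod_primeFactors_of_squarefree (hsf.squarefree_of_dvd (hFdvd d hd))
  have hinj : Set.InjOn Nat.primeFactors (S : Set ℕ) := fun a ha b hb hab => by
    rw [← hprod a (hSF ha), ← hprod b (hSF hb), hab]
  have hdiff : ∀ U ∈ S.image Nat.primeFactors \\ S.image Nat.primeFactors,
      ∃ a ∈ S, ∃ b ∈ S, a.primeFactors \ b.primeFactors = U := by
    intro U hU
    simpa [Finset.mem_diffs] using hU
  have hdvd : ∀ a ∈ S, ∀ b ∈ S, b * ∏ p ∈ a.primeFactors \ b.primeFactors, p ∣ M := by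
    intro a ha b hb
    have hunion : b * ∏ p ∈ a.primeFactors \ b.primeFactors, p
        = ∏ p ∈ b.primeFactors ∪ a.primeFactors, p := by
      rw [← Finset.union_sdiff_self_eq_union, Finset.prod_union Finset.disjoint_sdiff,
        hprod b (hSF hb)]
    rw [hunion, ← Nat.prod_primeFactors_of_squarefree hsf]
    exact Finset.prod_dvd_prod_of_subset _ _ _ (Finset.union_subset
      (Nat.primeFactors_mono (hFdvd b (hSF hb)) hM) (Nat.primeFactors_mono (hFdvd a (hSF ha)) hM))
  rw [← Finset.card_image_of_injOn hinj]
  refine (Finset.card_le_card_diffs _).trans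
    (Finset.card_le_card_of_injOn (fun U => M / ∏ p ∈ U, p) ?_ ?_)
  · intro U hU
    obtain ⟨a, ha, b, hb, rfl⟩ := hdiff U hU
    have hbq := hdvd a ha b hb
    have hq := (Dvd.intro_left b rfl).trans hbq
    simp only [Finset.coe_filter, Set.mem_ofPred_eq]
    refine ⟨hFup b (hSF hb) _ (Nat.dvd_div_of_mul_dvd (by rwa [mul_comm]))
      (Nat.div_dvd_of_dvd hq), a, ha, ?_⟩
    rw [Nat.div_div_self hq hM]
    conv_rhs => rw [← hprod a (hSF ha)]
    exact Finset.prod_dvd_prod_of_subset _ _ _ Finset.sdiff_subset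
  · intro U hU V hV hUV
    obtain ⟨a, ha, b, hb, rfl⟩ := hdiff U hU
    obtain ⟨c, hc, d, hd, rfl⟩ := hdiff V hV
    have hq := (Dvd.intro_left b rfl).trans (hdvd a ha b hb)
    have hr := (Dvd.intro_left d rfl).trans (hdvd c hc d hd)
    have hqr : ∏ p ∈ a.primeFactors \ b.primeFactors, p
        = ∏ p ∈ c.primeFactors \ d.primeFactors, p := by
      rw [← Nat.div_div_self hq hM, ← Nat.div_div_self hr hM]
      exact congrArg (M / ·) hUV
    have hprime : ∀ x y : ℕ, ∀ p ∈ x.primeFactors \ y.primeFactors, p.Prime := fun x y p hp =>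
      Nat.prime_of_mem_primeFactors (Finset.sdiff_subset hp)
    rw [← Nat.primeFactors_prod (hprime a b), hqr, Nat.primeFactors_prod (hprime c d)]

/-- **Theorem D.** Let `M` be a squarefree positive integer, `d̄' = M/d` for `d ∣ M`.
If `F` is a set of divisors of `M` closed upward under divisibility among divisors of
`M`, then there is a permutation `σ` of `F` such that `σ(d)‾' ∣ d` for every
`d ∈ F`. -/
theorem stmt_17 (M : ℕ) (hM : 0 < M) (hsf : Squarefree M)
    (F : Finset ℕ) (hFdvd : ∀ d ∈ F, d ∣ M)
    (hFup : ∀ d ∈ F, ∀ e, d ∣ e → e ∣ M → e ∈ F) :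
    ∃ σ : ℕ → ℕ, Set.BijOn σ ↑F ↑F ∧ ∀ d ∈ F, (M / σ d) ∣ d := by
  classical
  obtain ⟨f, hf, hft⟩ := (Finset.all_card_le_biUnion_card_iff_exists_injective
    fun d : {d // d ∈ F} => F.filter fun e => M / e ∣ d).1 (by
      intro S
      rw [← Finset.card_map (Function.Embedding.subtype _)]
      refine (card_le_card_filter_div_dvd hsf hFdvd hFup ?_).trans (Finset.card_le_card ?_)
      · intro d hd
        obtain ⟨x, -, rfl⟩ := Finset.mem_map.1 hd
        exact x.2
      · intro e he
        obtain ⟨heF, d, hd, hed⟩ := Finset.mem_filter.1 he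
        obtain ⟨x, hx, rfl⟩ := Finset.mem_map.1 hd
        exact Finset.mem_biUnion.2 ⟨x, hx, Finset.mem_filter.2 ⟨heF, hed⟩⟩)
  let σ : ℕ → ℕ := fun d => if h : d ∈ F then f ⟨d, h⟩ else d
  have hσ : ∀ d (h : d ∈ F), σ d = f ⟨d, h⟩ := fun d h => dif_pos h
  have hmaps : Set.MapsTo σ F F := fun d hd => by
    rw [hσ d hd]
    exact (Finset.mem_filter.1 (hft ⟨d, hd⟩)).1
  have hinj : Set.InjOn σ F := fun a ha b hb hab => by
    rw [hσ a ha, hσ b hb] at hab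
    exact congrArg Subtype.val (hf hab)
  refine ⟨σ, ⟨hmaps, hinj, Finset.surjOn_of_injOn_of_card_le σ hmaps hinj le_rfl⟩, ?_⟩
  intro d hd
  rw [hσ d hd]
  exact (Finset.mem_filter.1 (hft ⟨d, hd⟩)).2
end

section
/- Let p_1, ..., p_n be distinct primes, let α_1 ≥ ... ≥ α_u > α_{u+1} = ... = α_n = 1 (with u = 0 if all α_i equal 1), and let N = p_1^{α_1}···p_n^{α_n}. Let T be a set of positive divisors of p_{u+1}···p_n such that: (a) no two elements of T are coprime; (b) no element of T divides another element of T; and (c) every divisor of p_{u+1}···p_n is either coprime to some element of T or divisible by some element of T. Then R(T, N) is a maximal N-set and d(R(T, N)) = T. -/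
open Finset

/-- With `α₁ ≥ ⋯ ≥ α_u > α_{u+1} = ⋯ = α_n = 1` (0-indexed), `N = p₁^{α₁} ⋯ p_n^{α_n}`
and `P = p_{u+1} ⋯ p_n`: if `T` is a set of positive divisors of `P` such that (a) no
two elements of `T` are coprime, (b) no element of `T` divides another element of `T`,
and (c) every divisor of `P` is either coprime to some element of `T` or divisible by
some element of `T`, then `R(T, N)` is a maximal `N`-set and `d(R(T, N)) = T`. -/
theorem stmt_19 (n u : ℕ) (hu : u < n) (p α : Fin n → ℕ)
    (hp : ∀ i, (p i).Prime) (hinj : Function.Injective p)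
    (hanti : ∀ i j : Fin n, i ≤ j → α j ≤ α i)
    (hconst : ∀ i : Fin n, u ≤ (i : ℕ) → α i = 1)
    (hstrict : ∀ i : Fin n, (i : ℕ) < u → 1 < α i)
    (N : ℕ) (hN : N = ∏ i, p i ^ α i)
    (P : ℕ) (hP : P = ∏ i ∈ Finset.univ.filter (fun i : Fin n => u ≤ (i : ℕ)), p i)
    (T : Finset ℕ) (hT : ∀ t ∈ T, t ∣ P)
    (ha : ∀ t ∈ T, ∀ t' ∈ T, Nat.gcd t t' ≠ 1)
    (hb : ∀ t ∈ T, ∀ t' ∈ T, t ∣ t' → t = t')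
    (hc : ∀ l, l ∣ P → (∃ t ∈ T, Nat.gcd l t = 1) ∨ (∃ t ∈ T, t ∣ l)) :
    IsMaxNSet N (RSet T N) ∧ dSet (RSet T N) = T := by
  have hPN : P ∣ N := by
    rw [hP, hN]
    have h : ∏ i ∈ Finset.univ.filter (fun i : Fin n => u ≤ (i : ℕ)), p i =
        ∏ i ∈ Finset.univ.filter (fun i : Fin n => u ≤ (i : ℕ)), p i ^ α i :=
      Finset.prod_congr rfl fun i hi => by rw [hconst i (Finset.mem_filter.1 hi).2, pow_one]
    rw [h]
    exact Finset.prod_dvd_prod_of_subset _ _ _ (Finset.filter_subset _ _)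
  have hN0 : N ≠ 0 := by
    rw [hN]
    exact Finset.prod_ne_zero_iff.2 fun i _ => pow_ne_zero _ (hp i).ne_zero
  have hmem : ∀ l, l ∈ RSet T N ↔ l ∣ N ∧ ∃ t ∈ T, t ∣ l := fun l => by
    simp [RSet, hN0]
  have hTR : ∀ t ∈ T, t ∈ RSet T N := fun t ht =>
    (hmem t).2 ⟨(hT t ht).trans hPN, t, ht, dvd_rfl⟩
  refine ⟨⟨⟨fun d hd => ((hmem d).1 hd).1, ?_⟩, ?_⟩, ?_⟩
  · intro d hd e he hde
    obtain ⟨-, t, ht, htd⟩ := (hmem d).1 hd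
    obtain ⟨-, t', ht', hte⟩ := (hmem e).1 he
    exact ha t ht t' ht' (Nat.Coprime.of_dvd htd hte hde)
  · intro l hl hlR
    rcases hc (Nat.gcd l P) (Nat.gcd_dvd_right l P) with ⟨t, ht, hlt⟩ | ⟨t, ht, htl⟩
    · refine ⟨t, hTR t ht, ?_⟩
      rwa [Nat.gcd_assoc, Nat.gcd_eq_right (hT t ht)] at hlt
    · exact absurd ((hmem l).2 ⟨hl, t, ht, htl.trans (Nat.gcd_dvd_left l P)⟩) hlR
  · ext d
    simp only [dSet, Finset.mem_filter]
    constructor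
    · rintro ⟨hd, hmin⟩
      obtain ⟨-, t, ht, htd⟩ := (hmem d).1 hd
      exact hmin t (hTR t ht) htd ▸ ht
    · intro hd
      refine ⟨hTR d hd, fun e he hed => ?_⟩
      obtain ⟨-, t, ht, hte⟩ := (hmem e).1 he
      exact Nat.dvd_antisymm hed (hb t ht d hd (hte.trans hed) ▸ hte)
end
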